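/- A hypergraph is $\beta$-acyclic (admits a sequence of $\beta$-leaves exhausting all nodes) if and only if it contains no $\beta$-cycle. -/

import Mathlib

open Finset

variable {V : Type*} [DecidableEq V]

/-- Removal of a node from a hypergraph edge set: erase `v` from every edge and keep the
nonempty results. -/
def eraseNodeE (E : Finset (Finset V)) (v : V) : Finset (Finset V) :=
  (E.image fun e => e.erase v).filter fun e => e.Nonempty

/-- `v` is a β-leaf: the edges containing `v` are totally ordered by inclusion. -/
def BetaLeaf (E : Finset (Finset V)) (v : V) : Prop :=
  ∀ e ∈ E, ∀ f ∈ E, v ∈ e → v ∈ f → e ⊆ f ∨ f ⊆ e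

/-- Successive removal of a list of nodes. -/
def removeList (E : Finset (Finset V)) (l : List V) : Finset (Finset V) :=
  l.foldl eraseNodeE E

/-- β-acyclicity: there is an ordering of all nodes which is a sequence of β-leaves. -/
def BetaAcyclic [Fintype V] (E : Finset (Finset V)) : Prop :=
  ∃ l : List V, l.Nodup ∧ (∀ v : V, v ∈ l) ∧
    ∀ i : ℕ, ∀ h : i < l.length, BetaLeaf (removeList E (l.take i)) (l.get ⟨i, h⟩)

/-- `E` contains a β-cycle: distinct nodes `v₁, …, v_q` and distinct edges `e₁, …, e_q`
(`q ≥ 3`) with `vᵢ ∈ e_{i-1} ∩ eᵢ` (cyclically) and `vᵢ` in no other edge of the cycle. -/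
def HasBetaCycle (E : Finset (Finset V)) : Prop :=
  ∃ (q : ℕ) (hq : 3 ≤ q) (vs : Fin q → V) (es : Fin q → Finset V),
    Function.Injective vs ∧ Function.Injective es ∧ (∀ i, es i ∈ E) ∧
    ∀ i : Fin q, vs i ∈ es (i - ⟨1, by omega⟩) ∧ vs i ∈ es i ∧
      ∀ j, j ≠ i - ⟨1, by omega⟩ → j ≠ i → vs i ∉ es j

/-- The rows of the relation `M`, ordered by `σ`, are lexicographically increasing when the columns
are read in decreasing order of `τ`. -/
def RowsLex {R C : Type*} (M : R → C → Prop) (σ : R → ℕ) (τ : C → ℕ) : Prop :=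
  ∀ a b, σ a < σ b → ∀ e, M a e → ¬ M b e →
    ∃ f, τ e < τ f ∧ M b f ∧ ¬ M a f ∧ ∀ g, τ f < τ g → (M a g ↔ M b g)

open Classical in
theorem rowsLex_of_sum_le {R C : Type*} [Fintype R] [Fintype C] (M : R → C → Prop)
    {n : ℕ} (σ : R ≃ Fin n) (τ : C → ℕ) (hτ : Function.Injective τ)
    (hmax : ∀ σ' : R ≃ Fin n,
      ∑ a, 2 ^ (σ' a : ℕ) * ∑ e with M a e, 2 ^ τ e ≤
        ∑ a, 2 ^ (σ a : ℕ) * ∑ e with M a e, 2 ^ τ e) :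
    RowsLex M (fun a => (σ a : ℕ)) τ := by
  intro a b hab e hae hbe
  dsimp only at hab
  have hne : a ≠ b := by rintro rfl; exact lt_irrefl _ hab
  obtain ⟨f, hf, hfmax⟩ := Finset.exists_max_image
    (Finset.univ.filter fun g => ¬ (M a g ↔ M b g)) τ ⟨e, by simp [hae, hbe]⟩
  have hfd : ¬ (M a f ↔ M b f) := by simpa using hf
  have hgt : ∀ g, τ f < τ g → (M a g ↔ M b g) := by
    intro g hg
    by_contra h
    exact absurd (hfmax g (by simpa using h)) (by omega)
  have hef : τ e ≤ τ f := hfmax e (by simp [hae, hbe])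
  by_cases hbf : M b f
  · have haf : ¬ M a f := fun h => hfd (by simp [h, hbf])
    refine ⟨f, lt_of_le_of_ne hef fun h => ?_, hbf, haf, hgt⟩
    exact haf (hτ h ▸ hae)
  exfalso
  have haf : M a f := by
    by_contra h
    exact hfd (by simp [h, hbf])
  set S : R → ℕ := fun x => ∑ e with M x e, 2 ^ τ e with hS
  have himg : ∀ x, S x = ∑ i ∈ (Finset.univ.filter fun e => M x e).image τ, 2 ^ i := by
    intro x
    rw [Finset.sum_image hτ.injOn]
  have hlt : S b < S a := by
    rw [himg, himg, Finset.geomSum_lt_geomSum_iff_toColex_lt_toColex le_rfl,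
      Finset.Colex.toColex_lt_toColex_iff_exists_forall_lt]
    refine ⟨τ f, by simpa using ⟨f, haf, rfl⟩, ?_, ?_⟩
    · simp only [Finset.mem_image, Finset.mem_filter, Finset.mem_univ, true_and, not_exists,
        not_and]
      intro g hg h
      exact hbf (hτ h ▸ hg)
    · simp only [Finset.mem_image, Finset.mem_filter, Finset.mem_univ, true_and, not_exists,
        not_and]
      rintro _ ⟨g, hg, rfl⟩ h
      have hga : ¬ M a g := fun h' => h g h' rfl
      refine lt_of_le_of_ne (hfmax g (by simp [hg, hga])) fun h' => ?_
      exact hbf (hτ h' ▸ hg)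
  have h := hmax ((Equiv.swap a b).trans σ)
  have split : ∀ F : R → ℕ, ∑ x, F x = F a + (F b + ∑ x ∈ (univ.erase a).erase b, F x) := by
    intro F
    rw [Finset.add_sum_erase _ _ (by simp [hne.symm]), Finset.add_sum_erase _ _ (by simp)]
  rw [split, split] at h
  have hrest : ∑ x ∈ (univ.erase a).erase b, 2 ^ (((Equiv.swap a b).trans σ) x : ℕ) * S x =
      ∑ x ∈ (univ.erase a).erase b, 2 ^ (σ x : ℕ) * S x := by
    refine Finset.sum_congr rfl fun x hx => ?_
    simp only [Finset.mem_erase] at hx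
    rw [Equiv.trans_apply, Equiv.swap_apply_of_ne_of_ne hx.2.1 hx.1]
  change 2 ^ (((Equiv.swap a b).trans σ) a : ℕ) * S a +
    (2 ^ (((Equiv.swap a b).trans σ) b : ℕ) * S b +
      ∑ x ∈ (univ.erase a).erase b, 2 ^ (((Equiv.swap a b).trans σ) x : ℕ) * S x) ≤
    2 ^ (σ a : ℕ) * S a + (2 ^ (σ b : ℕ) * S b +
      ∑ x ∈ (univ.erase a).erase b, 2 ^ (σ x : ℕ) * S x) at h
  rw [hrest] at h
  simp only [Equiv.trans_apply, Equiv.swap_apply_left, Equiv.swap_apply_right] at h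
  have hpow : 2 ^ (σ a : ℕ) < 2 ^ (σ b : ℕ) := Nat.pow_lt_pow_right (by norm_num) hab
  nlinarith

/-- Every finite relation admits a doubly lexical ordering. -/
theorem exists_doubly_lex {R C : Type*} [Fintype R] [Fintype C] (M : R → C → Prop) :
    ∃ (σ : R → ℕ) (τ : C → ℕ), Function.Injective σ ∧ Function.Injective τ ∧
      RowsLex M σ τ ∧ RowsLex (flip M) τ σ := by
  classical
  let W : (R ≃ Fin (Fintype.card R)) × (C ≃ Fin (Fintype.card C)) → ℕ := fun p =>
    ∑ a, 2 ^ (p.1 a : ℕ) * ∑ e with M a e, 2 ^ (p.2 e : ℕ)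
  have : Nonempty ((R ≃ Fin (Fintype.card R)) × (C ≃ Fin (Fintype.card C))) :=
    ⟨(Fintype.equivFin R, Fintype.equivFin C)⟩
  obtain ⟨⟨σ, τ⟩, hmax⟩ := Finite.exists_max W
  have hW : ∀ p, W p = ∑ e, 2 ^ (p.2 e : ℕ) * ∑ a with flip M e a, 2 ^ (p.1 a : ℕ) := by
    intro p
    simp only [W, flip, Finset.mul_sum]
    refine (Finset.sum_comm' (t' := univ) (s' := fun e => univ.filter fun a => M a e)
      (by simp)).trans ?_
    exact Finset.sum_congr rfl fun e _ => Finset.sum_congr rfl fun a _ => mul_comm _ _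
  have hσ : Function.Injective fun a => (σ a : ℕ) := Fin.val_injective.comp σ.injective
  have hτ : Function.Injective fun e => (τ e : ℕ) := Fin.val_injective.comp τ.injective
  refine ⟨_, _, hσ, hτ, rowsLex_of_sum_le M σ _ hτ fun σ' => hmax (σ', τ),
    rowsLex_of_sum_le (flip M) τ _ hσ fun τ' => ?_⟩
  have h := hmax (σ, τ')
  rw [hW, hW] at h
  exact h

/-- A chordless zigzag of `k` rows and `k` columns, each increasing, in which two consecutive rows
agree on every column beyond the one that extends the zigzag at the later of them. -/
structure Zigzag {R C : Type*} (M : R → C → Prop) (σ : R → ℕ) (τ : C → ℕ) (k : ℕ)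
    (r : ℕ → R) (c : ℕ → C) : Prop where
  row_lt : ∀ i, i + 1 < k → σ (r i) < σ (r (i + 1))
  col_lt : ∀ i, i + 1 < k → τ (c i) < τ (c (i + 1))
  adj : ∀ i < k, ∀ j < k, (M (r i) (c j) ↔ i = j + 1 ∨ j = i + 1 ∨ (i = 0 ∧ j = 0))
  row_agree : ∀ i, i + 2 < k → ∀ e, τ (c (i + 2)) < τ e → (M (r i) e ↔ M (r (i + 1)) e)
  col_agree : ∀ i, i + 2 < k → ∀ a, σ (r (i + 2)) < σ a → (M a (c i) ↔ M a (c (i + 1)))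

theorem Zigzag.flip {R C : Type*} {M : R → C → Prop} {σ : R → ℕ} {τ : C → ℕ} {k : ℕ}
    {r : ℕ → R} {c : ℕ → C} (h : Zigzag M σ τ k r c) : Zigzag (flip M) τ σ k c r where
  row_lt := h.col_lt
  col_lt := h.row_lt
  adj i hi j hj := (h.adj j hj i hi).trans (by omega)
  row_agree := h.col_agree
  col_agree := h.row_agree

theorem lt_of_lt_succ_below {k : ℕ} {f : ℕ → ℕ} (h : ∀ i, i + 1 < k → f i < f (i + 1)) :
    ∀ i j, i < j → j < k → f i < f j := by
  intro i j hij
  induction j, hij using Nat.le_induction with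
  | base => exact h i
  | succ j hij ih => exact fun hj => (ih (by omega)).trans (h j hj)

theorem Zigzag.exists_next_col {R C : Type*} {M : R → C → Prop} {σ : R → ℕ} {τ : C → ℕ} {k : ℕ}
    {r : ℕ → R} {c : ℕ → C} (h : Zigzag M σ τ (k + 2) r c) (hM : RowsLex M σ τ) :
    ∃ f, τ (c (k + 1)) < τ f ∧ (∀ i < k + 2, (M (r i) f ↔ i = k + 1)) ∧
      ∀ g, τ f < τ g → (M (r k) g ↔ M (r (k + 1)) g) := by
  obtain ⟨f, hf, hbf, haf, hg⟩ := hM (r k) (r (k + 1)) (h.row_lt k (by omega)) (c (k + 1))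
    ((h.adj _ (by omega) _ (by omega)).2 (by omega))
    (fun h' => by have := (h.adj _ (by omega) _ (by omega)).1 h'; omega)
  have hlow : ∀ j ≤ k, ¬ M (r (k - j)) f := by
    intro j
    induction j with
    | zero => exact fun _ => haf
    | succ j ih =>
      intro hj
      have hlt : τ (c (k - (j + 1) + 2)) < τ f := by
        rcases (show k - (j + 1) + 2 ≤ k + 1 by omega).eq_or_lt with h' | h'
        · rwa [h']
        · exact (lt_of_lt_succ_below (f := fun i => τ (c i)) h.col_lt _ _ h' (by omega)).trans hf
      rw [h.row_agree _ (by omega) f hlt, show k - (j + 1) + 1 = k - j by omega]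
      exact ih (by omega)
  refine ⟨f, hf, fun i hi => ⟨fun hif => ?_, fun hik => hik ▸ hbf⟩, hg⟩
  by_contra hne
  refine hlow (k - i) (by omega) ?_
  rwa [show k - (k - i) = i by omega]

/-- The rows `r i` and columns `c i` for `i < k` form a chordless cycle. -/
def ClosedZigzag {R C : Type*} (M : R → C → Prop) (k : ℕ) (r : ℕ → R) (c : ℕ → C) : Prop :=
  ∀ i < k, ∀ j < k, (M (r i) (c j) ↔
    i = j + 1 ∨ j = i + 1 ∨ (i = 0 ∧ j = 0) ∨ (i + 1 = k ∧ j + 1 = k))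

theorem Zigzag.extend {R C : Type*} {M : R → C → Prop} {σ : R → ℕ} {τ : C → ℕ} {k : ℕ}
    {r : ℕ → R} {c : ℕ → C} (h : Zigzag M σ τ (k + 2) r c) (hM : RowsLex M σ τ)
    (hM' : RowsLex (_root_.flip M) τ σ) :
    ∃ r' c', ClosedZigzag M (k + 3) r' c' ∨ Zigzag M σ τ (k + 3) r' c' := by
  obtain ⟨f, hf, hfa, hfg⟩ := h.exists_next_col hM
  obtain ⟨b, hb, hba, hbg⟩ := h.flip.exists_next_col hM'
  simp only [_root_.flip] at hba hbg
  have hr : ∀ i, i < k + 2 → Function.update r (k + 2) b i = r i := fun i hi =>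
    Function.update_of_ne (by omega) _ _
  have hc : ∀ i, i < k + 2 → Function.update c (k + 2) f i = c i := fun i hi =>
    Function.update_of_ne (by omega) _ _
  have hrk : Function.update r (k + 2) b (k + 2) = b := Function.update_self ..
  have hck : Function.update c (k + 2) f (k + 2) = f := Function.update_self ..
  refine ⟨Function.update r (k + 2) b, Function.update c (k + 2) f, ?_⟩
  by_cases hbf : M b f
  · left
    intro i hi j hj
    rcases (show i < k + 2 ∨ i = k + 2 by omega) with hi | rfl <;>
    rcases (show j < k + 2 ∨ j = k + 2 by omega) with hj | rfl
    · rw [hr i hi, hc j hj, h.adj i hi j hj]; omega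
    · rw [hr i hi, hck, hfa i hi]; omega
    · rw [hrk, hc j hj, hba j hj]; omega
    · rw [hrk, hck]; simp [hbf]
  · right
    constructor
    · intro i hi
      rcases (show i + 1 < k + 2 ∨ i = k + 1 by omega) with hi | rfl
      · rw [hr i (by omega), hr _ hi]; exact h.row_lt i hi
      · rw [hr _ (by omega), hrk]; exact hb
    · intro i hi
      rcases (show i + 1 < k + 2 ∨ i = k + 1 by omega) with hi | rfl
      · rw [hc i (by omega), hc _ hi]; exact h.col_lt i hi
      · rw [hc _ (by omega), hck]; exact hf
    · intro i hi j hj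
      rcases (show i < k + 2 ∨ i = k + 2 by omega) with hi | rfl <;>
      rcases (show j < k + 2 ∨ j = k + 2 by omega) with hj | rfl
      · rw [hr i hi, hc j hj, h.adj i hi j hj]
      · rw [hr i hi, hck, hfa i hi]; omega
      · rw [hrk, hc j hj, hba j hj]; omega
      · rw [hrk, hck]; simp [hbf]
    · intro i hi
      rw [hr i (by omega), hr (i + 1) (by omega)]
      rcases (show i + 2 < k + 2 ∨ i = k by omega) with hi | rfl
      · rw [hc _ hi]; exact h.row_agree i hi
      · rw [hck]; exact hfg
    · intro i hi
      rw [hc i (by omega), hc (i + 1) (by omega)]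
      rcases (show i + 2 < k + 2 ∨ i = k by omega) with hi | rfl
      · rw [hr _ hi]; exact h.col_agree i hi
      · rw [hrk]; exact hbg

theorem Zigzag.exists_closedZigzag {R C : Type*} [Finite R] {M : R → C → Prop} {σ : R → ℕ}
    {τ : C → ℕ} {r : ℕ → R} {c : ℕ → C} (h : Zigzag M σ τ 2 r c) (hM : RowsLex M σ τ)
    (hM' : RowsLex (_root_.flip M) τ σ) :
    ∃ k r' c', ClosedZigzag M (k + 3) r' c' := by
  by_contra! hno
  have hall : ∀ k, ∃ r' c', Zigzag M σ τ (k + 2) r' c' := by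
    intro k
    induction k with
    | zero => exact ⟨r, c, h⟩
    | succ k ih =>
      obtain ⟨r', c', h'⟩ := ih
      obtain ⟨r'', c'', h'' | h''⟩ := h'.extend hM hM'
      · exact absurd h'' (hno _ _ _)
      · exact ⟨r'', c'', h''⟩
  obtain ⟨r', c', h'⟩ := hall (Nat.card R)
  have hinj : Function.Injective fun i : Fin (Nat.card R + 2) => r' i := by
    have hmono : StrictMono fun i : Fin (Nat.card R + 2) => σ (r' i) := fun i j hij =>
      lt_of_lt_succ_below (f := fun i => σ (r' i)) h'.row_lt _ _ hij j.2
    intro i j hij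
    exact hmono.injective (congrArg σ hij)
  have := Nat.card_le_card_of_injective _ hinj
  simp at this

theorem Fin.val_sub_one_eq_ite {q : ℕ} (hq : 1 < q) (i : Fin q) :
    (i - ⟨1, hq⟩ : Fin q).val = if i.val = 0 then q - 1 else i.val - 1 := by
  rw [Fin.val_sub]
  have := i.2
  split_ifs with h
  · rw [h, Nat.add_zero]
    exact Nat.mod_eq_of_lt (by simp only; omega)
  · rw [show q - 1 + i.val = (i.val - 1) + q by omega, Nat.add_mod_right]
    exact Nat.mod_eq_of_lt (by omega)

theorem ClosedZigzag.hasBetaCycle {V : Type*} {E : Finset (Finset V)} {s : Finset V} {k : ℕ}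
    {r : ℕ → s} {c : ℕ → E}
    (h : ClosedZigzag (fun (a : s) (e : E) => (a : V) ∈ (e : Finset V)) (k + 3) r c) :
    HasBetaCycle E := by
  let ρ : ℕ → ℕ := fun i => if 2 * i - 1 < k + 3 then 2 * i - 1 else 2 * (k + 3 - i)
  let γ : ℕ → ℕ := fun i => if 2 * i < k + 3 then 2 * i else 2 * (k + 3 - i) - 1
  have hρ : ∀ i < k + 3, ρ i < k + 3 := by
    intro i hi; simp only [ρ]; split_ifs <;> omega
  have hγ : ∀ i < k + 3, γ i < k + 3 := by
    intro i hi; simp only [γ]; split_ifs <;> omega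
  have key : ∀ i j : Fin (k + 3), ((r (ρ i) : V) ∈ (c (γ j) : Finset V) ↔
      j = i - ⟨1, by omega⟩ ∨ j = i) := by
    intro i j
    have hi := i.2
    have hj := j.2
    refine (h _ (hρ i hi) _ (hγ j hj)).trans ?_
    rw [Fin.ext_iff, Fin.ext_iff, Fin.val_sub_one_eq_ite (by omega)]
    simp only [ρ, γ]
    split_ifs <;> omega
  refine ⟨k + 3, by omega, fun i => r (ρ i), fun i => c (γ i), ?_, ?_, fun i => (c (γ i)).2,
    fun i => ⟨(key i _).2 (Or.inl rfl), (key i _).2 (Or.inr rfl), fun j h1 h2 h3 => ?_⟩⟩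
  · intro i j hij
    dsimp only at hij
    have h1 := (key i i).2 (Or.inr rfl)
    have h2 := (key i _).2 (Or.inl rfl)
    have h3 := (key j j).2 (Or.inr rfl)
    rw [hij, key] at h1 h2
    rw [← hij, key] at h3
    simp only [Fin.ext_iff, Fin.val_sub_one_eq_ite] at h1 h2 h3 ⊢
    split_ifs at h1 h2 h3 <;> omega
  · intro i j hij
    dsimp only at hij
    by_contra hne
    have h1 := (key i i).2 (Or.inr rfl)
    have h2 := (key j j).2 (Or.inr rfl)
    rw [hij, key] at h1
    rw [← hij, key] at h2
    simp only [Fin.ext_iff, Fin.val_sub_one_eq_ite] at h1 h2 hne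
    split_ifs at h1 h2 <;> omega
  · rcases (key i j).1 h3 with h | h
    exacts [h1 h, h2 h]

theorem exists_betaLeaf {E : Finset (Finset V)} {s : Finset V} (hs : s.Nonempty)
    (hE : ∀ e ∈ E, e ⊆ s) (hno : ¬ HasBetaCycle E) : ∃ v ∈ s, BetaLeaf E v := by
  let M : s → E → Prop := fun a e => (a : V) ∈ (e : Finset V)
  obtain ⟨σ, τ, hσ, hτ, hM, hM'⟩ := exists_doubly_lex M
  have hs' : Nonempty s := hs.to_subtype
  obtain ⟨v, hv⟩ := Finite.exists_min σ
  have key : ∀ e f : E, τ e < τ f → M v e → M v f → (e : Finset V) ⊆ f := by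
    intro e f hef hve hvf x hx
    by_contra hxf
    let y : s := ⟨x, hE e e.2 hx⟩
    have hye : M y e := hx
    have hyf : ¬ M y f := hxf
    have hvy : σ v < σ y := lt_of_le_of_ne (hv y) fun h => hyf (hσ h ▸ hvf)
    have hz : Zigzag M σ τ 2 (fun i => if i = 0 then v else y) (fun i => if i = 0 then e else f) :=
      { row_lt := fun i hi => by
          obtain rfl : i = 0 := by omega
          simpa using hvy
        col_lt := fun i hi => by
          obtain rfl : i = 0 := by omega
          simpa using hef
        adj := fun i hi j hj => by
          interval_cases i <;> interval_cases j <;> simp [hve, hvf, hye, hyf]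
        row_agree := fun i hi => by omega
        col_agree := fun i hi => by omega }
    obtain ⟨k, r, c, hc⟩ := hz.exists_closedZigzag hM hM'
    exact hno hc.hasBetaCycle
  refine ⟨v, v.2, fun e he f hf hve hvf => ?_⟩
  rcases lt_trichotomy (τ ⟨e, he⟩) (τ ⟨f, hf⟩) with h | h | h
  · exact Or.inl (key _ _ h hve hvf)
  · exact Or.inl (Subtype.ext_iff.1 (hτ h)).subset
  · exact Or.inr (key _ _ h hvf hve)

theorem mem_eraseNodeE {E : Finset (Finset V)} {v : V} {f : Finset V} :
    f ∈ eraseNodeE E v ↔ (∃ e ∈ E, e.erase v = f) ∧ f.Nonempty := by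
  simp [eraseNodeE]

theorem HasBetaCycle.of_eraseNodeE {E : Finset (Finset V)} {v : V}
    (h : HasBetaCycle (eraseNodeE E v)) : HasBetaCycle E := by
  obtain ⟨q, hq, vs, es, hvs, hes, hE, hc⟩ := h
  choose fs hfs hfe using fun i => (mem_eraseNodeE.1 (hE i)).1
  have hne : ∀ i, vs i ≠ v := fun i hi => by
    have := (hc i).2.1
    rw [← hfe, hi] at this
    simp at this
  have hmem : ∀ i j, vs i ∈ es j ↔ vs i ∈ fs j := fun i j => by
    rw [← hfe]; simp [hne]
  refine ⟨q, hq, vs, fs, hvs, fun i j hij => hes (by rw [← hfe, ← hfe, hij]), hfs, fun i => ?_⟩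
  simpa only [hmem] using hc i

theorem HasBetaCycle.eraseNodeE_of_betaLeaf {E : Finset (Finset V)} {v : V}
    (h : HasBetaCycle E) (hv : BetaLeaf E v) : HasBetaCycle (eraseNodeE E v) := by
  obtain ⟨q, hq, vs, es, hvs, hes, hE, hc⟩ := h
  have key : ∀ i j, vs i ∈ es j ↔ j = i - ⟨1, by omega⟩ ∨ j = i := by
    intro i j
    refine ⟨fun h => ?_, ?_⟩
    · by_contra! h'
      exact (hc i).2.2 j h'.1 h'.2 h
    · rintro (rfl | rfl)
      exacts [(hc i).1, (hc j).2.1]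
  have hsucc : ∀ i : Fin q, ∃ j : Fin q, j - ⟨1, by omega⟩ = i := by
    intro i
    by_cases hi : i.val + 1 = q
    · refine ⟨⟨0, by omega⟩, ?_⟩
      rw [Fin.ext_iff, Fin.val_sub_one_eq_ite, if_pos rfl]
      omega
    · refine ⟨⟨i.val + 1, by omega⟩, ?_⟩
      rw [Fin.ext_iff, Fin.val_sub_one_eq_ite, if_neg (Nat.succ_ne_zero _)]
      rfl
  have hne : ∀ i, vs i ≠ v := by
    rintro i rfl
    obtain ⟨j, hj⟩ := hsucc i
    have hij := congrArg Fin.val hj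
    rcases hv _ (hE (i - ⟨1, by omega⟩)) _ (hE i) (hc i).1 (hc i).2.1 with h | h
    · have := (key _ _).1 (h (hc (i - ⟨1, by omega⟩)).2.1)
      simp only [Fin.ext_iff, Fin.val_sub_one_eq_ite] at this
      split_ifs at this <;> omega
    · have hjm : vs j ∈ es i := (key j i).2 (Or.inl hj.symm)
      have := (key _ _).1 (h hjm)
      simp only [Fin.ext_iff, Fin.val_sub_one_eq_ite] at this hij
      split_ifs at this hij <;> omega
  have hmem : ∀ i j, vs i ∈ (es j).erase v ↔ vs i ∈ es j := fun i j => by simp [hne]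
  refine ⟨q, hq, vs, fun i => (es i).erase v, hvs, fun i j hij => ?_,
    fun i => mem_eraseNodeE.2 ⟨⟨_, hE i, rfl⟩, vs i, (hmem _ _).2 (hc i).2.1⟩, fun i => ?_⟩
  · dsimp only at hij
    by_contra hne'
    have h1 := (hmem i i).2 (hc i).2.1
    have h2 := (hmem j j).2 (hc j).2.1
    rw [hij, hmem, key] at h1
    rw [← hij, hmem, key] at h2
    simp only [Fin.ext_iff, Fin.val_sub_one_eq_ite] at h1 h2 hne'
    split_ifs at h1 h2 <;> omega
  · simpa only [hmem] using hc i

theorem exists_betaLeaf_list (n : ℕ) : ∀ (s : Finset V) (E : Finset (Finset V)), s.card = n →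
    (∀ e ∈ E, e ⊆ s) → ¬ HasBetaCycle E →
    ∃ l : List V, l.Nodup ∧ (∀ v, v ∈ l ↔ v ∈ s) ∧
      ∀ i : ℕ, ∀ h : i < l.length, BetaLeaf (removeList E (l.take i)) (l.get ⟨i, h⟩) := by
  induction n with
  | zero =>
    intro s E hs _ _
    obtain rfl := Finset.card_eq_zero.1 hs
    exact ⟨[], by simp⟩
  | succ n ih =>
    intro s E hs hE hno
    obtain ⟨v, hv, hleaf⟩ := exists_betaLeaf (Finset.card_pos.1 (by omega)) hE hno
    obtain ⟨l, hnd, hl, hlist⟩ := ih (s.erase v) (eraseNodeE E v)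
      (by rw [Finset.card_erase_of_mem hv]; omega)
      (fun e he => by
        obtain ⟨⟨f, hf, rfl⟩, -⟩ := mem_eraseNodeE.1 he
        exact Finset.erase_subset_erase _ (hE f hf))
      (fun h => hno h.of_eraseNodeE)
    refine ⟨v :: l, List.nodup_cons.2 ⟨by simp [hl], hnd⟩, fun w => ?_, fun i hi => ?_⟩
    · rw [List.mem_cons, hl, Finset.mem_erase]
      by_cases hw : w = v
      · simp [hw, hv]
      · simp [hw]
    · cases i with
      | zero => exact hleaf
      | succ i => exact hlist i (by simpa using hi)

theorem not_hasBetaCycle_of_betaLeaf_list (l : List V) : ∀ E : Finset (Finset V),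
    (∀ v, v ∈ l ∨ ∀ e ∈ E, v ∉ e) →
    (∀ i : ℕ, ∀ h : i < l.length, BetaLeaf (removeList E (l.take i)) (l.get ⟨i, h⟩)) →
    ¬ HasBetaCycle E := by
  induction l with
  | nil =>
    rintro E hl - ⟨q, hq, vs, es, -, -, hE, hc⟩
    let i : Fin q := ⟨0, by omega⟩
    exact (hl (vs i)).elim (by simp) fun h => h _ (hE i) (hc i).2.1
  | cons v l ih =>
    intro E hl hleaf h
    refine ih (eraseNodeE E v) (fun w => ?_) (fun i hi => hleaf (i + 1) (by simpa using hi))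
      (h.eraseNodeE_of_betaLeaf (hleaf 0 (by simp)))
    rcases hl w with hw | hw
    · rcases List.mem_cons.1 hw with rfl | hw
      · right
        intro e he
        obtain ⟨⟨f, hf, rfl⟩, -⟩ := mem_eraseNodeE.1 he
        simp
      · exact Or.inl hw
    · right
      intro e he
      obtain ⟨⟨f, hf, rfl⟩, -⟩ := mem_eraseNodeE.1 he
      exact fun h => hw f hf (Finset.mem_of_mem_erase h)

/-- A hypergraph is β-acyclic (admits a sequence of β-leaves exhausting all
nodes) if and only if it contains no β-cycle. -/
theorem stmt_13 [Fintype V] (E : Finset (Finset V)) (hE : ∀ e ∈ E, 2 ≤ e.card) :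
    BetaAcyclic E ↔ ¬ HasBetaCycle E := by
  constructor
  · rintro ⟨l, -, hl, hleaf⟩
    exact not_hasBetaCycle_of_betaLeaf_list l E (fun v => Or.inl (hl v)) hleaf
  · intro h
    obtain ⟨l, hnd, hl, hleaf⟩ := exists_betaLeaf_list _ univ E rfl (fun e _ => e.subset_univ) h
    exact ⟨l, hnd, fun v => (hl v).2 (mem_univ v), hleaf⟩
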